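/- In the group algebra of $S_n$, for compositions $\kappa$ and $\nu$ of $n$, the product $B_\kappa B_\nu$ equals $\sum_{\mathbf{z}} B_\eta$, where the sum ranges over all matrices $\mathbf{z} = (z_{ij})$ of non-negative integers with column sums $\sum_i z_{ij} = \kappa_j$ and row sums $\sum_j z_{ij} = \nu_i$, and $\eta$ is the composition of $n$ obtained by reading the nonzero entries of $\mathbf{z}$ row by row. -/

import Mathlib

open Equiv Pointwise

/-- The copy of `Sₙ` inside `Equiv.Perm ℕ`: permutations fixing every point `≥ n`
(we use points `0,…,n-1` instead of `1,…,n`). -/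
def symN (n : ℕ) : Subgroup (Equiv.Perm ℕ) where
  carrier := {x | ∀ i, n ≤ i → x i = i}
  one_mem' := fun _ _ => rfl
  mul_mem' := by
    intro a b ha hb i hi
    simp only [Set.mem_setOf_eq] at *
    simp [Equiv.Perm.mul_apply, hb i hi, ha i hi]
  inv_mem' := by
    intro a ha i hi
    simp only [Set.mem_setOf_eq] at *
    conv_lhs => rw [← ha i hi]
    simp

/-- The number of inversions (the Coxeter length in `Sₙ`). -/
def invNum (n : ℕ) (x : Equiv.Perm ℕ) : ℕ :=
  ((Finset.range n ×ˢ Finset.range n).filter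
    (fun p => p.1 < p.2 ∧ x p.2 < x p.1)).card

/-- The adjacent transpositions `(k, k+1)` for `k ∈ J`. -/
def gens (J : Set ℕ) : Set (Equiv.Perm ℕ) := (fun k => Equiv.swap k (k + 1)) '' J

/-- The parabolic subgroup `W_J`. -/
def parabolic (J : Set ℕ) : Subgroup (Equiv.Perm ℕ) := Subgroup.closure (gens J)

/-- `x ∈ X_J`: a minimal length left coset representative of `W_J` in `Sₙ`. -/
def isMinLeft (n : ℕ) (J : Set ℕ) (x : Equiv.Perm ℕ) : Prop :=
  x ∈ symN n ∧ ∀ w ∈ parabolic J, invNum n x ≤ invNum n (x * w)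

/-- `x ∈ X_J⁻¹`: a minimal length right coset representative of `W_J` in `Sₙ`. -/
def isMinRight (n : ℕ) (J : Set ℕ) (x : Equiv.Perm ℕ) : Prop :=
  x ∈ symN n ∧ ∀ w ∈ parabolic J, invNum n x ≤ invNum n (w * x)

/-- `i1` and `j1` lie in the same connected component of the graph `𝒥` with
edges `(k, k+1)` for `k ∈ J`. -/
def sameComp (J : Set ℕ) (i j : ℕ) : Prop :=
  ∀ t, min i j ≤ t → t < max i j → t ∈ J

/-- The vertex set of the connected component of the graph of `J` containing `a`. -/
def comp (J : Set ℕ) (a : ℕ) : Set ℕ := {b | sameComp J a b}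

/-- `c` is a composition of `n`. -/
def isComposition (n : ℕ) (c : List ℕ) : Prop := c.sum = n ∧ ∀ k ∈ c, 0 < k

/-- The `q`-th consecutive block determined by a composition `c`. -/
def blockSet (c : List ℕ) (q : ℕ) : Set ℕ := Set.Ico ((c.take q).sum) ((c.take (q + 1)).sum)

/-- The set of adjacent transpositions corresponding to a composition `c`:
those `(i, i+1)` with `i, i+1` in the same block. -/
def edgesOf (c : List ℕ) : Set ℕ := {i | ∃ q, i ∈ blockSet c q ∧ i + 1 ∈ blockSet c q}

/-- `i` indexes an edge `(i, i+1)` of the image graph `x⁻¹𝒥`, i.e. `(x i, x (i+1))`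
is an edge of `𝒥` (as an unordered pair). -/
def imgEdges (x : Equiv.Perm ℕ) (J : Set ℕ) : Set ℕ :=
  {i | ∃ t ∈ J, (x i = t ∧ x (i + 1) = t + 1) ∨ (x i = t + 1 ∧ x (i + 1) = t)}

/-- The basis element `B_ν = ∑_{σ ∈ X_ν} σ` of the descent algebra, in the group
algebra `ℤ[Sₙ]` (realized inside the monoid algebra of `Equiv.Perm ℕ`). -/
noncomputable def B (n : ℕ) (ν : List ℕ) : MonoidAlgebra ℤ (Equiv.Perm ℕ) :=
  ∑ᶠ σ ∈ {x | isMinLeft n (edgesOf ν) x}, MonoidAlgebra.single σ (1 : ℤ)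


/-- The reading word of a matrix `z`: the nonzero entries read row by row. -/
def readingWord {s r : ℕ} (z : Fin s → Fin r → ℕ) : List ℕ :=
  (List.finRange s).flatMap fun i => ((List.finRange r).map (z i)).filter (fun t => t != 0)

lemma symN_lt {n : ℕ} {x : Equiv.Perm ℕ} (hx : x ∈ symN n) {a : ℕ} (ha : a < n) : x a < n := by
  by_contra h
  push Not at h
  have h1 : x (x a) = x a := hx _ h
  have := x.injective h1
  omega

lemma lab_parabolic {J : Set ℕ} {f : ℕ → ℕ} (hJ : ∀ i ∈ J, f i = f (i + 1))
    {w : Equiv.Perm ℕ} (hw : w ∈ parabolic J) : ∀ a, f (w a) = f a := by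
  unfold parabolic at hw
  induction hw using Subgroup.closure_induction with
  | mem x hx =>
    obtain ⟨k, hk, rfl⟩ := hx
    intro a
    have := hJ k hk
    simp only [Equiv.swap_apply_def]
    split_ifs <;> simp_all
  | one => intro a; rfl
  | mul x y _ _ hx hy => intro a; rw [Equiv.Perm.mul_apply, hx, hy]
  | inv x _ hx => intro a; rw [← hx (x⁻¹ a)]; simp

lemma parabolic_symN {n : ℕ} {J : Set ℕ} (hJ : ∀ i ∈ J, i + 1 < n) : parabolic J ≤ symN n := by
  unfold parabolic
  rw [Subgroup.closure_le]
  rintro _ ⟨k, hk, rfl⟩ i hi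
  have := hJ k hk
  apply Equiv.swap_apply_of_ne_of_ne <;> omega

lemma isMinLeft_iff {n : ℕ} {J : Set ℕ} {f : ℕ → ℕ} (hf : Monotone f)
    (hJ : ∀ i, i ∈ J ↔ i + 1 < n ∧ f i = f (i + 1)) (x : Equiv.Perm ℕ) :
    isMinLeft n J x ↔ x ∈ symN n ∧ ∀ a b, a < b → b < n → f a = f b → x a < x b := by
  constructor
  · rintro ⟨hx, hmin⟩
    refine ⟨hx, ?_⟩
    have key : ∀ k ∈ J, x k < x (k + 1) := by
      intro k hk
      by_contra hlt
      have hne : x k ≠ x (k + 1) := fun h => by have := x.injective h; omega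
      have hlt' : x (k + 1) < x k := by omega
      have hkn := ((hJ k).1 hk).1
      have h1 := hmin (Equiv.swap k (k + 1)) (Subgroup.subset_closure ⟨k, hk, rfl⟩)
      refine absurd h1 (not_le.2 ?_)
      unfold invNum
      set s := Equiv.swap k (k + 1) with hs
      have sv : ∀ a, s a = if a = k then k + 1 else if a = k + 1 then k else a := fun a =>
        Equiv.swap_apply_def _ _ _
      have hmem : (k, k + 1) ∈ ((Finset.range n ×ˢ Finset.range n).filter
          (fun p => p.1 < p.2 ∧ x p.2 < x p.1)) := by
        simp; omega
      rw [← Finset.card_erase_add_one hmem, Nat.lt_succ_iff]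
      refine Finset.card_le_card_of_injOn (fun p => (s p.1, s p.2)) ?_ ?_
      · rintro ⟨a, b⟩ hp
        replace hp := Finset.mem_filter.1 (Finset.mem_coe.1 hp)
        simp only [Finset.mem_product, Finset.mem_range, Equiv.Perm.mul_apply] at hp
        obtain ⟨⟨ha, hb⟩, hab, hx'⟩ := hp
        have hnot : ¬ (a = k ∧ b = k + 1) := by
          rintro ⟨rfl, rfl⟩
          simp [hs] at hx'
          omega
        simp only [Finset.mem_coe, Finset.mem_erase, Finset.mem_filter, Finset.mem_product,
          Finset.mem_range, ne_eq, Prod.mk.injEq]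
        refine ⟨?_, ⟨?_, ?_⟩, ?_, hx'⟩
        all_goals simp only [sv]; split_ifs <;> omega
      · rintro ⟨a, b⟩ _ ⟨c, d⟩ _ h
        simpa using h
    intro a b hab
    induction b, hab using Nat.le_induction with
    | base => intro hb hfe; exact key a ((hJ a).2 ⟨hb, hfe⟩)
    | succ b hab ih =>
      intro hb hfe
      have h1 : f a ≤ f b := hf (by omega)
      have h2 : f b ≤ f (b + 1) := hf (by omega)
      exact (ih (by omega) (by omega)).trans (key b ((hJ b).2 ⟨hb, by omega⟩))
  · rintro ⟨hx, hinc⟩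
    refine ⟨hx, fun w hw => ?_⟩
    have hwi : w⁻¹ ∈ parabolic J := inv_mem hw
    have hfw := lab_parabolic (f := f) (fun i hi => ((hJ i).1 hi).2) hwi
    have hwn : w⁻¹ ∈ symN n := parabolic_symN (fun i hi => ((hJ i).1 hi).1) hwi
    unfold invNum
    refine Finset.card_le_card_of_injOn (fun p => (w⁻¹ p.1, w⁻¹ p.2)) ?_ ?_
    · rintro ⟨a, b⟩ hp
      simp only [Finset.mem_coe, Finset.mem_filter, Finset.mem_product, Finset.mem_range] at hp
      obtain ⟨⟨ha, hb⟩, hab, hx'⟩ := hp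
      have hne : f a ≠ f b := fun h => by have := hinc a b hab hb h; omega
      have hle : f a ≤ f b := hf hab.le
      simp only [Finset.mem_coe, Finset.mem_filter, Finset.mem_product, Finset.mem_range]
      refine ⟨⟨symN_lt hwn ha, symN_lt hwn hb⟩, ?_, by simpa using hx'⟩
      by_contra hcon
      have := hf (not_lt.1 hcon)
      rw [hfw, hfw] at this
      omega
    · rintro ⟨a, b⟩ _ ⟨c, d⟩ _ h
      simpa using h

/-- Restriction of an element of `symN n` to `Fin n`. -/
def toFinPerm (n : ℕ) (x : Equiv.Perm ℕ) (hx : x ∈ symN n) : Equiv.Perm (Fin n) where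
  toFun a := ⟨x a, symN_lt hx a.2⟩
  invFun a := ⟨x⁻¹ a, symN_lt (inv_mem hx) a.2⟩
  left_inv a := by simp
  right_inv a := by simp

/-- Extension of a permutation of `Fin n` to `ℕ`. -/
def ofFinPerm (n : ℕ) (y : Equiv.Perm (Fin n)) : Equiv.Perm ℕ :=
  y.extendDomain (Fin.equivSubtype (n := n))

lemma ofFinPerm_lt (n : ℕ) (y : Equiv.Perm (Fin n)) (a : ℕ) (ha : a < n) :
    ofFinPerm n y a = y ⟨a, ha⟩ := by
  unfold ofFinPerm
  rw [Equiv.Perm.extendDomain_apply_subtype (p := fun a => a < n) _ _ ha]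
  rfl

lemma ofFinPerm_mem (n : ℕ) (y : Equiv.Perm (Fin n)) : ofFinPerm n y ∈ symN n := by
  intro a ha
  exact Equiv.Perm.extendDomain_apply_not_subtype _ _ (by omega)

lemma symN_ext {n : ℕ} {x y : Equiv.Perm ℕ} (hx : x ∈ symN n) (hy : y ∈ symN n)
    (h : ∀ a < n, x a = y a) : x = y := by
  ext a
  by_cases ha : a < n
  · exact h a ha
  · rw [hx a (by omega), hy a (by omega)]

lemma symN_finite (n : ℕ) : {x | x ∈ symN n}.Finite := by
  refine (Set.finite_range (ofFinPerm n)).subset ?_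
  intro x hx
  refine ⟨toFinPerm n x hx, symN_ext (ofFinPerm_mem _ _) hx fun a ha => ?_⟩
  rw [ofFinPerm_lt _ _ _ ha]
  rfl

/-- Size of the fibre of `f` over `q` in `range n`. -/
def fib (n : ℕ) (f : ℕ → ℕ) (q : ℕ) : ℕ := ((Finset.range n).filter (fun a => f a = q)).card

lemma fib_comp {n : ℕ} {x : Equiv.Perm ℕ} (hx : x ∈ symN n) (P : ℕ → Prop)
    [DecidablePred P] :
    ((Finset.range n).filter (fun a => P (x a))).card = ((Finset.range n).filter P).card := by
  refine Finset.card_bij' (fun a _ => x a) (fun a _ => x⁻¹ a) ?_ ?_ ?_ ?_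
  · intro a ha
    simp only [Finset.mem_filter, Finset.mem_range] at ha ⊢
    exact ⟨symN_lt hx ha.1, ha.2⟩
  · intro a ha
    simp only [Finset.mem_filter, Finset.mem_range] at ha ⊢
    exact ⟨symN_lt (inv_mem hx) ha.1, by simpa using ha.2⟩
  · intro a _; simp
  · intro a _; simp

lemma mono_unique {n : ℕ} {f g : ℕ → ℕ}
    (hf : ∀ a b, a ≤ b → b < n → f a ≤ f b) (hg : ∀ a b, a ≤ b → b < n → g a ≤ g b)
    (h : ∀ q, fib n f q = fib n g q) : ∀ a < n, f a = g a := by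
  have key : ∀ f : ℕ → ℕ, (∀ a b, a ≤ b → b < n → f a ≤ f b) → ∀ q, ∀ a < n,
      (f a ≤ q ↔ a < ∑ p ∈ Finset.range (q + 1), fib n f p) := by
    intro f hf q a ha
    have h1 : ∑ p ∈ Finset.range (q + 1), fib n f p
        = ((Finset.range n).filter (fun a => f a ≤ q)).card := by
      rw [Finset.card_eq_sum_card_fiberwise (f := f) (t := Finset.range (q + 1))]
      · refine Finset.sum_congr rfl fun p hp => ?_
        unfold fib
        congr 1
        ext b
        simp only [Finset.mem_filter, Finset.mem_range] at *
        omega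
      · intro b hb
        simp at *
        omega
    rw [h1]
    constructor
    · intro hq
      have : Finset.range (a + 1) ⊆ (Finset.range n).filter (fun a => f a ≤ q) := by
        intro b hb
        simp only [Finset.mem_filter, Finset.mem_range] at *
        have := hf b a (by omega) ha
        omega
      have := Finset.card_le_card this
      simp at this
      omega
    · intro hlt
      by_contra hq
      have : (Finset.range n).filter (fun a => f a ≤ q) ⊆ Finset.range a := by
        intro b hb
        simp only [Finset.mem_filter, Finset.mem_range] at *
        by_contra hb'
        have := hf a b (by omega) hb.1
        omega
      have := Finset.card_le_card this
      simp at this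
      omega
  intro a ha
  apply le_antisymm
  · rw [key f hf _ a ha]
    simp only [h]
    rw [← key g hg _ a ha]
  · rw [key g hg _ a ha]
    simp only [← h]
    rw [← key f hf _ a ha]

lemma sort_exists {n : ℕ} {k h : ℕ → ℕ} (hk : ∀ a b, a ≤ b → b < n → k a ≤ k b)
    (hkh : ∀ q, fib n h q = fib n k q) :
    ∃ σ ∈ symN n, (∀ a < n, h (σ a) = k a) ∧
      ∀ a b, a < b → b < n → k a = k b → σ a < σ b := by
  let H : Fin n → ℕ := fun a => h a
  obtain ⟨h1, h2⟩ := (Tuple.eq_sort_iff (f := H) (σ := Tuple.sort H)).1 rfl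
  have hm := ofFinPerm_mem n (Tuple.sort H)
  set σ := ofFinPerm n (Tuple.sort H) with hσ
  have e : ∀ a < n, h (σ a) = k a := by
    refine mono_unique (f := fun a => h (σ a)) ?_ hk ?_
    · intro a b hab hb
      have := @h1 ⟨a, by omega⟩ ⟨b, hb⟩ hab
      simp only [hσ, ofFinPerm_lt _ _ a (by omega : a < n), ofFinPerm_lt _ _ b hb]
      exact this
    · intro q
      rw [← hkh]
      exact fib_comp hm (fun b => h b = q)
  refine ⟨σ, hm, e, fun a b hab hb hkab => ?_⟩
  rw [← e a (by omega), ← e b hb] at hkab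
  simp only [hσ, ofFinPerm_lt _ _ a (by omega : a < n), ofFinPerm_lt _ _ b hb] at hkab ⊢
  exact h2 ⟨a, by omega⟩ ⟨b, hb⟩ hab hkab

lemma sort_unique {n : ℕ} {k h : ℕ → ℕ} (hk : ∀ a b, a ≤ b → b < n → k a ≤ k b)
    {σ σ' : Equiv.Perm ℕ} (hσ : σ ∈ symN n) (hσ' : σ' ∈ symN n)
    (e : ∀ a < n, h (σ a) = k a) (e' : ∀ a < n, h (σ' a) = k a)
    (m : ∀ a b, a < b → b < n → k a = k b → σ a < σ b)
    (m' : ∀ a b, a < b → b < n → k a = k b → σ' a < σ' b) : σ = σ' := by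
  have key : ∀ σ : Equiv.Perm ℕ, ∀ hσ : σ ∈ symN n, (∀ a < n, h (σ a) = k a) →
      (∀ a b, a < b → b < n → k a = k b → σ a < σ b) →
      toFinPerm n σ hσ = Tuple.sort (fun a : Fin n => h a) := by
    intro σ hσ e m
    rw [Tuple.eq_sort_iff]
    constructor
    · intro a b hab
      simp only [Function.comp, toFinPerm, Equiv.coe_fn_mk]
      rw [e a a.2, e b b.2]
      exact hk _ _ hab b.2
    · intro a b hab heq
      simp only [toFinPerm, Equiv.coe_fn_mk] at heq ⊢
      rw [e a a.2, e b b.2] at heq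
      exact m a b hab b.2 heq
  have h3 := (key σ hσ e m).trans (key σ' hσ' e' m').symm
  refine symN_ext hσ hσ' fun a ha => ?_
  have := congrArg (fun y : Equiv.Perm (Fin n) => (y ⟨a, ha⟩ : ℕ)) h3
  exact this

/-- Block label. -/
def blk (c : List ℕ) (a : ℕ) : ℕ :=
  ((Finset.range c.length).filter (fun q => (c.take (q + 1)).sum ≤ a)).card

lemma blk_mono (c : List ℕ) : Monotone (blk c) := by
  intro a b hab
  apply Finset.card_le_card
  intro q hq
  simp only [Finset.mem_filter] at *
  exact ⟨hq.1, hq.2.trans hab⟩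

lemma take_sum_mono (c : List ℕ) {p q : ℕ} (h : p ≤ q) : (c.take p).sum ≤ (c.take q).sum :=
  (List.take_sublist_take_left h).sum_le_sum (by simp)

lemma blockSet_lt {c : List ℕ} {a q : ℕ} (h : a ∈ blockSet c q) : q < c.length := by
  by_contra hq
  rw [blockSet, List.take_of_length_le (by omega), List.take_of_length_le (by omega)] at h
  simp at h

lemma blk_of_mem {c : List ℕ} {a q : ℕ} (h : a ∈ blockSet c q) : blk c a = q := by
  have hq := blockSet_lt h
  unfold blk
  have : (Finset.range c.length).filter (fun q => (c.take (q + 1)).sum ≤ a) = Finset.range q := by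
    ext p
    simp only [Finset.mem_filter, Finset.mem_range]
    constructor
    · rintro ⟨_, h2⟩
      by_contra hp
      have := take_sum_mono c (p := q + 1) (q := p + 1) (by omega)
      have := h.2
      omega
    · intro hp
      have := take_sum_mono c (p := p + 1) (q := q) (by omega)
      exact ⟨by omega, this.trans h.1⟩
  rw [this, Finset.card_range]

lemma exists_block {c : List ℕ} {a : ℕ} (h : a < c.sum) : ∃ q, a ∈ blockSet c q := by
  have hex : ∃ q, a < (c.take q).sum := ⟨c.length, by simpa using h⟩
  classical
  have h1 := Nat.find_spec hex
  have h0 : Nat.find hex ≠ 0 := by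
    intro h0
    rw [h0] at h1
    simp at h1
  obtain ⟨q, hq⟩ := Nat.exists_eq_succ_of_ne_zero h0
  refine ⟨q, ?_, by rw [hq] at h1; exact h1⟩
  have := Nat.find_min hex (m := q) (by omega)
  omega

lemma mem_blockSet_iff {c : List ℕ} {a q : ℕ} (h : a < c.sum) : a ∈ blockSet c q ↔ blk c a = q := by
  refine ⟨blk_of_mem, ?_⟩
  rintro rfl
  obtain ⟨q, hq⟩ := exists_block h
  rw [blk_of_mem hq]
  exact hq

lemma blk_lt {c : List ℕ} {a : ℕ} (h : a < c.sum) : blk c a < c.length :=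
  blockSet_lt ((mem_blockSet_iff h).2 rfl)

lemma blockSet_sum {c : List ℕ} {a q : ℕ} (h : a ∈ blockSet c q) : a < c.sum := by
  refine lt_of_lt_of_le h.2 ?_
  exact (List.take_sublist _ _).sum_le_sum (by simp)

lemma mem_edgesOf (c : List ℕ) (i : ℕ) :
    i ∈ edgesOf c ↔ i + 1 < c.sum ∧ blk c i = blk c (i + 1) := by
  constructor
  · rintro ⟨q, h1, h2⟩
    exact ⟨blockSet_sum h2, by rw [blk_of_mem h1, blk_of_mem h2]⟩
  · rintro ⟨h1, h2⟩
    exact ⟨blk c i, (mem_blockSet_iff (by omega)).2 rfl, (mem_blockSet_iff h1).2 h2.symm⟩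

lemma fib_blk (c : List ℕ) (q : ℕ) : fib c.sum (blk c) q = c.getD q 0 := by
  unfold fib
  have : (Finset.range c.sum).filter (fun a => blk c a = q)
      = Finset.Ico (c.take q).sum (c.take (q + 1)).sum := by
    ext a
    simp only [Finset.mem_filter, Finset.mem_range, Finset.mem_Ico]
    constructor
    · rintro ⟨h1, h2⟩
      exact (mem_blockSet_iff h1).2 h2
    · intro h
      exact ⟨blockSet_sum (q := q) h, blk_of_mem (q := q) h⟩
  rw [this, Nat.card_Ico]
  by_cases hq : q < c.length
  · rw [List.take_succ_eq_append_getElem hq]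
    simp [hq]
  · rw [List.take_of_length_le (by omega), List.take_of_length_le (by omega)]
    simp [List.getD, not_lt.1 hq]

lemma edgesOf_cons (x : ℕ) (c : List ℕ) (i : ℕ) :
    i ∈ edgesOf (x :: c) ↔ i + 1 < x ∨ (x ≤ i ∧ i - x ∈ edgesOf c) := by
  simp only [edgesOf, blockSet, Set.mem_ofPred_eq, Set.mem_Ico]
  constructor
  · rintro ⟨q, h⟩
    cases q with
    | zero => left; simpa using h.2.2
    | succ q =>
      simp only [List.take_succ_cons, List.sum_cons] at h
      exact Or.inr ⟨by omega, q, by omega⟩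
  · rintro (h | ⟨h, q, hq⟩)
    · exact ⟨0, by simp; omega⟩
    · refine ⟨q + 1, ?_⟩
      simp only [List.take_succ_cons, List.sum_cons]
      omega

lemma edgesOf_filter (c : List ℕ) : edgesOf (c.filter (fun t => t != 0)) = edgesOf c := by
  induction c with
  | nil => rfl
  | cons x c ih =>
    by_cases hx : x = 0
    · subst hx
      simp only [bne_self_eq_false, Bool.false_eq_true, not_false_eq_true, List.filter_cons_of_neg, ih]
      ext i
      rw [edgesOf_cons]
      simp
    · rw [List.filter_cons_of_pos (by simpa using hx)]
      ext i
      rw [edgesOf_cons, edgesOf_cons, ih]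

/-- The entries of a matrix, row by row, zeros included. -/
def flat {s r : ℕ} (z : Fin s → Fin r → ℕ) : List ℕ :=
  List.ofFn (fun q : Fin (s * r) => z q.divNat q.modNat)

lemma idx_lt {s r i j : ℕ} (hi : i < s) (hj : j < r) : i * r + j < s * r := by
  nlinarith [Nat.mul_le_mul_right r (Nat.succ_le_of_lt hi)]

lemma idx_div {r i j : ℕ} (hj : j < r) : (i * r + j) / r = i := by
  rw [mul_comm, Nat.mul_add_div (by omega), Nat.div_eq_of_lt hj, add_zero]

lemma idx_mod {r i j : ℕ} (hj : j < r) : (i * r + j) % r = j := by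
  rw [mul_comm, Nat.mul_add_mod, Nat.mod_eq_of_lt hj]

lemma flat_eq {s r : ℕ} (z : Fin s → Fin r → ℕ) :
    flat z = (List.finRange s).flatMap fun i => (List.finRange r).map (z i) := by
  unfold flat
  rw [List.ofFn_mul, List.flatMap_def, ← List.ofFn_eq_map]
  congr 2
  funext i
  rw [← List.ofFn_eq_map]
  congr 1
  funext j
  congr 1
  · skip
    ext
    simp [Fin.divNat, idx_div j.2]
  · ext
    simp [Fin.modNat, Nat.mod_eq_of_lt j.2]

lemma readingWord_eq {s r : ℕ} (z : Fin s → Fin r → ℕ) :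
    readingWord z = (flat z).filter (fun t => t != 0) := by
  rw [flat_eq, List.filter_flatMap]
  rfl

lemma flat_sum {s r : ℕ} (z : Fin s → Fin r → ℕ) : (flat z).sum = ∑ i, ∑ j, z i j := by
  rw [flat_eq, List.flatMap_def, List.sum_flatten, List.map_map, ← List.ofFn_eq_map,
    List.sum_ofFn]
  refine Finset.sum_congr rfl fun i _ => ?_
  simp only [Function.comp]
  rw [← List.ofFn_eq_map, List.sum_ofFn]

lemma flat_getD {s r : ℕ} (z : Fin s → Fin r → ℕ) (i : Fin s) (j : Fin r) :
    (flat z).getD (i * r + j) 0 = z i j := by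
  have h := idx_lt i.2 j.2
  unfold flat
  rw [List.getD_eq_getElem _ _ (by simpa using h), List.getElem_ofFn]
  congr 1
  · ext
    simp [Fin.divNat, idx_div j.2]
  · ext
    simp [Fin.modNat, Nat.mod_eq_of_lt j.2]

lemma fib_congr {n : ℕ} {f g : ℕ → ℕ} (h : ∀ a < n, f a = g a) (q : ℕ) : fib n f q = fib n g q := by
  unfold fib
  congr 1
  apply Finset.filter_congr
  intro a ha
  rw [h a (Finset.mem_range.1 ha)]

lemma fib_zero {n : ℕ} {f : ℕ → ℕ} {q : ℕ} (h : ∀ a < n, f a ≠ q) : fib n f q = 0 := by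
  unfold fib
  rw [Finset.card_eq_zero, Finset.filter_eq_empty_iff]
  intro a ha
  exact h a (Finset.mem_range.1 ha)

lemma fib_row {n r : ℕ} {F : ℕ → ℕ} (hr : 0 < n → 0 < r) (i : ℕ) :
    ∑ j : Fin r, fib n F (i * r + j) = fib n (fun a => F a / r) i := by
  rw [Finset.sum_range (f := fun j => fib n F (i * r + j)) |>.symm]
  unfold fib
  rw [Finset.card_eq_sum_card_fiberwise (f := fun a => F a % r) (t := Finset.range r)]
  · refine Finset.sum_congr rfl fun j hj => ?_
    rw [Finset.mem_range] at hj
    congr 1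
    ext a
    simp only [Finset.mem_filter]
    constructor
    · rintro ⟨h1, h2⟩
      rw [h2, idx_div hj, idx_mod hj]
      exact ⟨⟨h1, rfl⟩, rfl⟩
    · rintro ⟨⟨h1, h2⟩, h3⟩
      refine ⟨h1, ?_⟩
      rw [← h2, ← h3, mul_comm]
      exact (Nat.div_add_mod _ _).symm
  · intro a ha
    simp only [Finset.mem_coe, Finset.mem_filter, Finset.mem_range] at ha ⊢
    exact Nat.mod_lt _ (hr (by omega))

lemma fib_col {n r s : ℕ} {F : ℕ → ℕ} (hF : ∀ a < n, F a < s * r) (j : ℕ) (hj : j < r) :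
    ∑ i : Fin s, fib n F (i * r + j) = fib n (fun a => F a % r) j := by
  rw [Finset.sum_range (f := fun i => fib n F (i * r + j)) |>.symm]
  unfold fib
  rw [Finset.card_eq_sum_card_fiberwise (f := fun a => F a / r) (t := Finset.range s)]
  · refine Finset.sum_congr rfl fun i hi => ?_
    congr 1
    ext a
    simp only [Finset.mem_filter]
    constructor
    · rintro ⟨h1, h2⟩
      rw [h2, idx_div hj, idx_mod hj]
      exact ⟨⟨h1, rfl⟩, rfl⟩
    · rintro ⟨⟨h1, h2⟩, h3⟩
      refine ⟨h1, ?_⟩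
      rw [← h2, ← h3, mul_comm]
      exact (Nat.div_add_mod _ _).symm
  · intro a ha
    simp only [Finset.mem_coe, Finset.mem_filter, Finset.mem_range] at ha ⊢
    exact Nat.div_lt_of_lt_mul (by rw [mul_comm]; exact hF a ha.1)

lemma getD_get (c : List ℕ) (i : Fin c.length) : c.getD i 0 = c.get i := by
  simp

/-- The matrices of the sum. -/
def matSet (κ ν : List ℕ) : Set (Fin ν.length → Fin κ.length → ℕ) :=
  {z | (∀ j, ∑ i, z i j = κ.get j) ∧ (∀ i, ∑ j, z i j = ν.get i)}

/-- The combined label of a position. -/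
def lab (κ ν : List ℕ) (τ : Equiv.Perm ℕ) (a : ℕ) : ℕ := blk ν a * κ.length + blk κ (τ a)

/-- The matrix of `τ`. -/
def matOf (n : ℕ) (κ ν : List ℕ) (τ : Equiv.Perm ℕ) : Fin ν.length → Fin κ.length → ℕ :=
  fun i j => fib n (lab κ ν τ) (i * κ.length + j)

lemma matSet_finite (κ ν : List ℕ) : (matSet κ ν).Finite := by
  refine (Set.finite_Iic (fun (_ : Fin ν.length) (j : Fin κ.length) => κ.get j)).subset ?_
  rintro z ⟨h1, _⟩ i j
  change z i j ≤ κ.get j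
  rw [← h1 j]
  exact Finset.single_le_sum (f := fun i => z i j) (fun _ _ => Nat.zero_le _) (Finset.mem_univ i)

section main
variable {n : ℕ} {κ ν : List ℕ}

/-- Membership in `X_c`, in terms of labels. -/
lemma isMinLeft_comp {c : List ℕ} (hc : c.sum = n) (x : Equiv.Perm ℕ) :
    isMinLeft n (edgesOf c) x ↔
      x ∈ symN n ∧ ∀ a b, a < b → b < n → blk c a = blk c b → x a < x b := by
  subst hc
  exact isMinLeft_iff (blk_mono c) (mem_edgesOf c) x

lemma flat_n (hν : ν.sum = n) {z : Fin ν.length → Fin κ.length → ℕ} (hz : z ∈ matSet κ ν) :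
    (flat z).sum = n := by
  rw [flat_sum, ← hν]
  simp only [hz.2]
  rw [← List.sum_ofFn]
  simp

lemma isMinLeft_mat (hν : ν.sum = n) {z : Fin ν.length → Fin κ.length → ℕ} (hz : z ∈ matSet κ ν)
    (x : Equiv.Perm ℕ) :
    isMinLeft n (edgesOf (readingWord z)) x ↔
      x ∈ symN n ∧ ∀ a b, a < b → b < n → blk (flat z) a = blk (flat z) b → x a < x b := by
  rw [readingWord_eq, edgesOf_filter]
  exact isMinLeft_comp (flat_n hν hz) x

lemma len_pos (hκ : κ.sum = n) (h : 0 < n) : 0 < κ.length := by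
  cases κ with
  | nil => simp at hκ; omega
  | cons => simp

lemma flat_lt (hν : ν.sum = n) {z : Fin ν.length → Fin κ.length → ℕ} (hz : z ∈ matSet κ ν)
    {a : ℕ} (ha : a < n) : blk (flat z) a < ν.length * κ.length := by
  have := blk_lt (c := flat z) (a := a) (by rw [flat_n hν hz]; exact ha)
  simpa [flat] using this

lemma fib_flat (hν : ν.sum = n) {z : Fin ν.length → Fin κ.length → ℕ} (hz : z ∈ matSet κ ν)
    (i : Fin ν.length) (j : Fin κ.length) :
    fib n (blk (flat z)) (i * κ.length + j) = z i j := by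
  rw [← flat_getD z i j, ← fib_blk, flat_n hν hz]

lemma flat_div (hκ : κ.sum = n) (hν : ν.sum = n) {z : Fin ν.length → Fin κ.length → ℕ}
    (hz : z ∈ matSet κ ν) : ∀ a < n, blk (flat z) a / κ.length = blk ν a := by
  refine mono_unique (fun a b hab _ => Nat.div_le_div_right (blk_mono _ hab))
    (fun a b hab _ => blk_mono _ hab) fun q => ?_
  by_cases hq : q < ν.length
  · rw [← fib_row (len_pos hκ)]
    have h1 := hz.2 ⟨q, hq⟩
    rw [← getD_get, ← fib_blk, hν] at h1
    rw [← h1]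
    exact Finset.sum_congr rfl fun j _ => fib_flat hν hz ⟨q, hq⟩ j
  · rw [fib_zero, fib_zero]
    · intro a ha
      have := blk_lt (c := ν) (a := a) (by omega)
      omega
    · intro a ha
      have := Nat.div_lt_of_lt_mul (by rw [mul_comm]; exact flat_lt hν hz ha)
      omega

lemma flat_mod_fib (hκ : κ.sum = n) (hν : ν.sum = n) {z : Fin ν.length → Fin κ.length → ℕ}
    (hz : z ∈ matSet κ ν) (q : ℕ) :
    fib n (fun a => blk (flat z) a % κ.length) q = fib n (blk κ) q := by
  by_cases hq : q < κ.length
  · rw [← fib_col (fun a ha => flat_lt hν hz ha) q hq]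
    have h1 := hz.1 ⟨q, hq⟩
    rw [← getD_get, ← fib_blk, hκ] at h1
    rw [← h1]
    exact Finset.sum_congr rfl fun i _ => fib_flat hν hz i ⟨q, hq⟩
  · rw [fib_zero, fib_zero]
    · intro a ha
      have := blk_lt (c := κ) (a := a) (by omega)
      omega
    · intro a ha
      have := Nat.mod_lt (blk (flat z) a) (len_pos hκ (by omega))
      omega

lemma blk_tau_lt (hκ : κ.sum = n) {τ : Equiv.Perm ℕ} (hτ : τ ∈ symN n) {a : ℕ} (ha : a < n) :
    blk κ (τ a) < κ.length := blk_lt (by rw [hκ]; exact symN_lt hτ ha)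

lemma lab_lt (hκ : κ.sum = n) (hν : ν.sum = n) {τ : Equiv.Perm ℕ} (hτ : τ ∈ symN n)
    {a : ℕ} (ha : a < n) : lab κ ν τ a < ν.length * κ.length :=
  idx_lt (blk_lt (by omega)) (blk_tau_lt hκ hτ ha)

lemma matOf_mem (hκ : κ.sum = n) (hν : ν.sum = n) {τ : Equiv.Perm ℕ} (hτ : τ ∈ symN n) :
    matOf n κ ν τ ∈ matSet κ ν := by
  constructor
  · intro j
    rw [← getD_get, ← fib_blk, hκ]
    unfold matOf
    rw [fib_col (fun a ha => lab_lt hκ hν hτ ha) j j.2]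
    rw [fib_congr (f := fun a => lab κ ν τ a % κ.length) (g := fun a => blk κ (τ a)) (fun a ha => idx_mod (blk_tau_lt hκ hτ ha))]
    exact fib_comp hτ (fun b => blk κ b = j)
  · intro i
    rw [← getD_get, ← fib_blk, hν]
    unfold matOf
    rw [fib_row (len_pos hκ)]
    exact fib_congr (fun a ha => idx_div (blk_tau_lt hκ hτ ha)) _

lemma lab_eq_flat (hκ : κ.sum = n) (hν : ν.sum = n) {τ : Equiv.Perm ℕ} (hτ : τ ∈ symN n)
    (hinc : ∀ a b, a < b → b < n → blk ν a = blk ν b → τ a < τ b) :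
    ∀ a < n, lab κ ν τ a = blk (flat (matOf n κ ν τ)) a := by
  have hz := matOf_mem hκ hν hτ
  refine mono_unique ?_ (fun a b hab _ => blk_mono _ hab) fun q => ?_
  · intro a b hab hb
    rcases hab.eq_or_lt with rfl | hab
    · exact le_rfl
    unfold lab
    rcases (blk_mono ν hab.le).eq_or_lt with h | h
    · have h1 := blk_mono κ (hinc a b hab hb h).le
      rw [h]
      omega
    · have h1 := blk_tau_lt hκ hτ (hab.trans hb)
      have := idx_lt h h1
      omega
  · by_cases hq : q < ν.length * κ.length
    · have hr : 0 < κ.length := Nat.pos_of_ne_zero (by rintro h; simp [h] at hq)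
      have h1 : q / κ.length < ν.length := Nat.div_lt_of_lt_mul (by rw [mul_comm]; exact hq)
      have h2 := Nat.mod_lt q hr
      have h3 := fib_flat hν hz ⟨_, h1⟩ ⟨_, h2⟩
      have h4 : q / κ.length * κ.length + q % κ.length = q := by
        rw [mul_comm]; exact Nat.div_add_mod _ _
      unfold matOf at h3
      simp only [h4] at h3
      exact h3.symm
    · rw [fib_zero, fib_zero]
      · intro a ha
        have := flat_lt hν hz ha
        omega
      · intro a ha
        have := lab_lt hκ hν hτ ha
        omega

lemma matOf_eq (hν : ν.sum = n) {z : Fin ν.length → Fin κ.length → ℕ}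
    (hz : z ∈ matSet κ ν) {τ : Equiv.Perm ℕ}
    (h : ∀ a < n, lab κ ν τ a = blk (flat z) a) : matOf n κ ν τ = z := by
  funext i j
  unfold matOf
  rw [fib_congr h, fib_flat hν hz]

lemma blk_tau_eq (hκ : κ.sum = n) (hν : ν.sum = n) {τ : Equiv.Perm ℕ} (hτ : τ ∈ symN n)
    (hinc : ∀ a b, a < b → b < n → blk ν a = blk ν b → τ a < τ b) {a : ℕ} (ha : a < n) :
    blk κ (τ a) = blk (flat (matOf n κ ν τ)) a % κ.length := by
  rw [← lab_eq_flat hκ hν hτ hinc a ha]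
  exact (idx_mod (blk_tau_lt hκ hτ ha)).symm

lemma solomon_prod_mem (hκ : κ.sum = n) (hν : ν.sum = n) {σ τ : Equiv.Perm ℕ}
    (hσ : isMinLeft n (edgesOf κ) σ) (hτ : isMinLeft n (edgesOf ν) τ) :
    isMinLeft n (edgesOf (readingWord (matOf n κ ν τ))) (σ * τ) := by
  rw [isMinLeft_comp hκ] at hσ
  rw [isMinLeft_comp hν] at hτ
  have hz := matOf_mem hκ hν hτ.1
  rw [isMinLeft_mat hν hz]
  refine ⟨mul_mem hσ.1 hτ.1, fun a b hab hb h => ?_⟩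
  have ha := hab.trans hb
  have h1 : blk ν a = blk ν b := by
    rw [← flat_div hκ hν hz a ha, ← flat_div hκ hν hz b hb, h]
  have h2 : blk κ (τ a) = blk κ (τ b) := by
    rw [blk_tau_eq hκ hν hτ.1 hτ.2 ha, blk_tau_eq hκ hν hτ.1 hτ.2 hb, h]
  exact hσ.2 _ _ (hτ.2 a b hab hb h1) (symN_lt hτ.1 hb) h2

lemma prod_inj (hκ : κ.sum = n) (hν : ν.sum = n) {σ τ σ' τ' : Equiv.Perm ℕ}
    (hσ : isMinLeft n (edgesOf κ) σ) (hτ : isMinLeft n (edgesOf ν) τ)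
    (hσ' : isMinLeft n (edgesOf κ) σ') (hτ' : isMinLeft n (edgesOf ν) τ')
    (hm : matOf n κ ν τ = matOf n κ ν τ') (hp : σ * τ = σ' * τ') : σ = σ' ∧ τ = τ' := by
  rw [isMinLeft_comp hκ] at hσ hσ'
  rw [isMinLeft_comp hν] at hτ hτ'
  have hs : σ = σ' := by
    refine sort_unique (n := n) (k := blk κ)
      (h := fun c => blk (flat (matOf n κ ν τ)) ((σ * τ)⁻¹ c) % κ.length)
      (fun a b hab _ => blk_mono _ hab) hσ.1 hσ'.1 ?_ ?_ hσ.2 hσ'.2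
    · intro a ha
      have := symN_lt (inv_mem hτ.1) ha
      simp only [mul_inv_rev, Equiv.Perm.mul_apply, Equiv.Perm.inv_def, Equiv.symm_apply_apply] at this ⊢
      rw [← blk_tau_eq hκ hν hτ.1 hτ.2 this]
      simp
    · intro a ha
      have := symN_lt (inv_mem hτ'.1) ha
      simp only [hp, hm]
      simp only [mul_inv_rev, Equiv.Perm.mul_apply, Equiv.Perm.inv_def, Equiv.symm_apply_apply] at this ⊢
      rw [← blk_tau_eq hκ hν hτ'.1 hτ'.2 this]
      simp
  subst hs
  exact ⟨rfl, mul_left_cancel hp⟩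

lemma prod_surj (hκ : κ.sum = n) (hν : ν.sum = n) {z : Fin ν.length → Fin κ.length → ℕ}
    (hz : z ∈ matSet κ ν) {π : Equiv.Perm ℕ} (hπ : isMinLeft n (edgesOf (readingWord z)) π) :
    ∃ σ τ, isMinLeft n (edgesOf κ) σ ∧ isMinLeft n (edgesOf ν) τ ∧ matOf n κ ν τ = z ∧
      σ * τ = π := by
  rw [isMinLeft_mat hν hz] at hπ
  obtain ⟨σ, hσ, h1, h2⟩ := sort_exists (n := n) (k := blk κ)
    (h := fun c => blk (flat z) (π⁻¹ c) % κ.length) (fun a b hab _ => blk_mono _ hab) (by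
      intro q
      rw [← flat_mod_fib hκ hν hz]
      exact fib_comp (inv_mem hπ.1) (fun b => blk (flat z) b % κ.length = q))
  have hτ : σ⁻¹ * π ∈ symN n := mul_mem (inv_mem hσ) hπ.1
  have hk : ∀ a < n, blk κ ((σ⁻¹ * π) a) = blk (flat z) a % κ.length := by
    intro a ha
    rw [← h1 _ (symN_lt hτ ha)]
    simp
  have hl : ∀ a < n, lab κ ν (σ⁻¹ * π) a = blk (flat z) a := by
    intro a ha
    unfold lab
    rw [hk a ha, ← flat_div hκ hν hz a ha, mul_comm]
    exact Nat.div_add_mod _ _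
  refine ⟨σ, σ⁻¹ * π, (isMinLeft_comp hκ _).2 ⟨hσ, h2⟩, (isMinLeft_comp hν _).2 ⟨hτ, ?_⟩,
    matOf_eq hν hz hl, by simp⟩
  intro a b hab hb h
  have ha := hab.trans hb
  by_contra hcon
  have hle := not_lt.1 hcon
  have hG : blk (flat z) a = blk (flat z) b := by
    apply le_antisymm (blk_mono _ hab.le)
    rw [← hl a ha, ← hl b hb]
    unfold lab
    have := blk_mono κ hle
    rw [h]
    omega
  have hlt := hπ.2 a b hab hb hG
  rcases hle.eq_or_lt with e | e
  · have := (σ⁻¹ * π).injective e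
    omega
  · have h3 := h2 _ _ e (symN_lt hτ ha) (by rw [hk a ha, hk b hb, hG])
    simp at h3
    omega

end main

lemma minSet_finite (n : ℕ) (J : Set ℕ) : {x | isMinLeft n J x}.Finite :=
  (symN_finite n).subset fun _ hx => hx.1

lemma B_eq (n : ℕ) (c : List ℕ) :
    B n c = ∑ σ ∈ (minSet_finite n (edgesOf c)).toFinset, MonoidAlgebra.single σ (1 : ℤ) :=
  finsum_mem_eq_finite_toFinset_sum _ _

/-- matrix form of Solomon's rule: in `ℤ[Sₙ]`,
`B_κ * B_ν = ∑_z B_η`, summed over all non-negative integer matrices `z` with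
column sums `κ` and row sums `ν`, where `η` is the reading word of `z`. -/
theorem stmt10 (n : ℕ) (κ ν : List ℕ)
    (hκ : isComposition n κ) (hν : isComposition n ν) :
    B n κ * B n ν =
      ∑ᶠ z ∈ {z : Fin ν.length → Fin κ.length → ℕ |
          (∀ j, ∑ i, z i j = κ.get j) ∧ (∀ i, ∑ j, z i j = ν.get i)},
        B n (readingWord z) := by
  have hk := hκ.1
  have hn := hν.1
  change _ = ∑ᶠ z ∈ matSet κ ν, B n (readingWord z)
  rw [finsum_mem_eq_finite_toFinset_sum _ (matSet_finite κ ν)]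
  simp only [B_eq]
  rw [Finset.sum_mul_sum, ← Finset.sum_product', Finset.sum_sigma']
  refine Finset.sum_bij (fun p _ => ⟨matOf n κ ν p.2, p.1 * p.2⟩) ?_ ?_ ?_ ?_
  · rintro ⟨σ, τ⟩ hp
    simp only [Finset.mem_product, Finset.mem_sigma, Set.Finite.mem_toFinset,
      Set.mem_ofPred_eq] at hp ⊢
    exact ⟨matOf_mem hk hn hp.2.1, solomon_prod_mem hk hn hp.1 hp.2⟩
  · rintro ⟨σ, τ⟩ hp ⟨σ', τ'⟩ hp' h
    simp only [Finset.mem_product, Set.Finite.mem_toFinset, Set.mem_ofPred_eq] at hp hp'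
    simp only [Sigma.mk.injEq, heq_eq_eq] at h
    obtain ⟨h1, h2⟩ := prod_inj hk hn hp.1 hp.2 hp'.1 hp'.2 h.1 h.2
    rw [h1, h2]
  · rintro ⟨z, π⟩ hp
    simp only [Finset.mem_sigma, Set.Finite.mem_toFinset, Set.mem_ofPred_eq] at hp
    obtain ⟨σ, τ, h1, h2, h3, h4⟩ := prod_surj hk hn hp.1 hp.2
    refine ⟨(σ, τ), ?_, ?_⟩
    · simp only [Finset.mem_product, Set.Finite.mem_toFinset, Set.mem_ofPred_eq]
      exact ⟨h1, h2⟩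
    · simp only [h3, h4]
  · rintro ⟨σ, τ⟩ _
    simp [MonoidAlgebra.single_mul_single]
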